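/- (Feynman–Kac fixed point formula for semilinear heat equations.) Let d ∈ ℕ, T ∈ (0,∞), let f: ℝ → ℝ be Lipschitz continuous, and let u ∈ C^{1,2}([0,T]×ℝ^d,ℝ) be a function which together with its time derivative and its first and second order spatial partial derivatives grows at most polynomially and which satisfies for all t ∈ [0,T], x ∈ ℝ^d that ∂u/∂t(t,x) = Δ_x u(t,x) + f(u(t,x)). Then for every t ∈ [0,T] and every x ∈ ℝ^d it holds that u(t,x) = ∫_{ℝ^d} u(0, x + √(2t) w) γ_d(dw) + ∫_0^t ∫_{ℝ^d} f( u(s, x + √(2(t−s)) w) ) γ_d(dw) ds. -/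

import Mathlib

open MeasureTheory ProbabilityTheory Set

noncomputable section

/-- First spatial partial derivative `∂g/∂x_i` of a function `g : ℝ^d → ℝ`. -/
def spatialPD1 (d : ℕ) (g : (Fin d → ℝ) → ℝ) (i : Fin d) (x : Fin d → ℝ) : ℝ :=
  fderiv ℝ g x (Pi.single i 1)

/-- Second spatial partial derivative `∂²g/(∂x_i ∂x_j)` of a function `g : ℝ^d → ℝ`. -/
def spatialPD2 (d : ℕ) (g : (Fin d → ℝ) → ℝ) (i j : Fin d) (x : Fin d → ℝ) : ℝ :=
  fderiv ℝ (fun y => fderiv ℝ g y (Pi.single i 1)) x (Pi.single j 1)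

/-- The Laplacian `Δg` of a function `g : ℝ^d → ℝ`. -/
def laplacian (d : ℕ) (g : (Fin d → ℝ) → ℝ) (x : Fin d → ℝ) : ℝ :=
  ∑ i : Fin d, spatialPD2 d g i i x

/-- `u ∈ C^{1,2}([α,β] × ℝ^d, ℝ)`: `u` is continuous, once continuously differentiable in
the time variable and twice continuously differentiable in the space variable, with all
partial derivatives jointly continuous. -/
def IsC12On (d : ℕ) (α β : ℝ) (u : ℝ → (Fin d → ℝ) → ℝ) : Prop :=
  ContinuousOn (fun p : ℝ × (Fin d → ℝ) => u p.1 p.2) (Icc α β ×ˢ univ) ∧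
  (∀ x, DifferentiableOn ℝ (fun t => u t x) (Icc α β)) ∧
  ContinuousOn (fun p : ℝ × (Fin d → ℝ) =>
    derivWithin (fun s => u s p.2) (Icc α β) p.1) (Icc α β ×ˢ univ) ∧
  (∀ t ∈ Icc α β, ContDiff ℝ 2 (u t)) ∧
  (∀ i : Fin d, ContinuousOn (fun p : ℝ × (Fin d → ℝ) => spatialPD1 d (u p.1) i p.2)
    (Icc α β ×ˢ univ)) ∧
  (∀ i j : Fin d, ContinuousOn (fun p : ℝ × (Fin d → ℝ) => spatialPD2 d (u p.1) i j p.2)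
    (Icc α β ×ˢ univ))

/-- `u` and its time derivative and first and second order spatial partial derivatives grow
at most polynomially on `[0,T] × ℝ^d`. -/
def HasPolyGrowthDerivs (d : ℕ) (T : ℝ) (u : ℝ → (Fin d → ℝ) → ℝ) : Prop :=
  ∃ c q : ℝ, 1 ≤ q ∧ ∀ t ∈ Icc (0:ℝ) T, ∀ x : Fin d → ℝ,
    |u t x| ≤ c * (1 + ∑ i, |x i|) ^ q ∧
    |derivWithin (fun s => u s x) (Icc (0:ℝ) T) t| ≤ c * (1 + ∑ i, |x i|) ^ q ∧
    (∀ i, |spatialPD1 d (u t) i x| ≤ c * (1 + ∑ i, |x i|) ^ q) ∧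
    (∀ i j, |spatialPD2 d (u t) i j x| ≤ c * (1 + ∑ i, |x i|) ^ q)

/-- The standard Gaussian measure on `ℝ^d` (the `d`-fold product of the standard
Gaussian measure on `ℝ`). -/
def stdGaussian (d : ℕ) : Measure (Fin d → ℝ) :=
  Measure.pi fun _ => gaussianReal 0 1

open Filter Topology

instance isProbabilityMeasure_stdGaussian (d : ℕ) : IsProbabilityMeasure (stdGaussian d) := by
  unfold _root_.stdGaussian; infer_instance

/-- Exponentials of the `ℓ¹`-norm are integrable against the standard Gaussian measure. -/
lemma integrable_exp_sum_abs_stdGaussian (d : ℕ) (r : ℝ) :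
    Integrable (fun w : Fin d → ℝ => Real.exp (r * ∑ i, |w i|)) (stdGaussian d) := by
  have h1 : Integrable (fun x : ℝ => Real.exp (r * |x|)) (gaussianReal 0 1) :=
    integrable_exp_mul_abs (X := fun x => x)
      (integrable_exp_mul_gaussianReal r) (integrable_exp_mul_gaussianReal (-r))
  have h2 := Integrable.fintype_prod (μ := fun _ : Fin d => gaussianReal 0 1)
    (f := fun _ x => Real.exp (r * |x|)) (fun _ => h1)
  refine h2.congr (ae_of_all _ fun w => ?_)
  simp only [Finset.mul_sum, Real.exp_sum]

lemma abs_apply_mul_exp_sum_abs_le {d : ℕ} (r : ℝ) (i : Fin d) (w : Fin d → ℝ) :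
    |w i| * Real.exp (r * ∑ j, |w j|) ≤ Real.exp ((r + 1) * ∑ j, |w j|) := by
  have h1 : |w i| ≤ ∑ j, |w j| :=
    Finset.single_le_sum (f := fun j => |w j|) (fun _ _ => abs_nonneg _) (Finset.mem_univ i)
  have h2 : ∑ j, |w j| ≤ Real.exp (∑ j, |w j|) := by
    linarith [Real.add_one_le_exp (∑ j, |w j|)]
  rw [add_mul, one_mul, Real.exp_add, mul_comm (Real.exp _)]
  gcongr
  exact h1.trans h2

lemma integrable_abs_mul_exp_sum_abs_stdGaussian {d : ℕ} (r : ℝ) (i : Fin d) :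
    Integrable (fun w : Fin d → ℝ => |w i| * Real.exp (r * ∑ j, |w j|)) (stdGaussian d) := by
  refine (integrable_exp_sum_abs_stdGaussian d (r + 1)).mono' (by fun_prop)
    (ae_of_all _ fun w => ?_)
  rw [Real.norm_of_nonneg (by positivity)]
  exact abs_apply_mul_exp_sum_abs_le r i w

lemma hasDerivAt_gaussianPDFReal_zero_one (x : ℝ) :
    HasDerivAt (gaussianPDFReal 0 1) (-(x * gaussianPDFReal 0 1 x)) x := by
  have h : HasDerivAt (fun y : ℝ => -(y - 0) ^ 2 / (2 * ((1 : NNReal) : ℝ))) (-x) x :=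
    ((((hasDerivAt_id x).sub_const 0).pow 2).neg.div_const (2 * ((1 : NNReal) : ℝ))).congr_deriv
      (by simp; ring)
  refine ((h.exp).const_mul ((√(2 * Real.pi * ((1 : NNReal) : ℝ)))⁻¹)).congr_deriv ?_
  simp only [gaussianPDFReal]
  ring

lemma integrable_gaussianReal_zero_one_iff {g : ℝ → ℝ} :
    Integrable g (gaussianReal 0 1) ↔ Integrable (fun x => gaussianPDFReal 0 1 x * g x) := by
  rw [gaussianReal_of_var_ne_zero _ one_ne_zero, integrable_withDensity_iff_integrable_smul'
    (measurable_gaussianPDF _ _) (ae_of_all _ fun _ => gaussianPDF_lt_top)]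
  simp [toReal_gaussianPDF]

/-- Gaussian integration by parts on the real line. -/
lemma integral_mul_eq_integral_deriv_gaussianReal {g g' : ℝ → ℝ}
    (hg : ∀ x, HasDerivAt g (g' x) x) (hint : Integrable g (gaussianReal 0 1))
    (hint' : Integrable g' (gaussianReal 0 1))
    (hmul : Integrable (fun x => x * g x) (gaussianReal 0 1)) :
    ∫ x, x * g x ∂gaussianReal 0 1 = ∫ x, g' x ∂gaussianReal 0 1 := by
  rw [integrable_gaussianReal_zero_one_iff] at hint hint' hmul
  have h := integral_mul_deriv_eq_deriv_mul_of_integrable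
    (u := gaussianPDFReal 0 1) (v := g) (fun x _ => hasDerivAt_gaussianPDFReal_zero_one x)
    (fun x _ => hg x) hint'
    (by refine hmul.neg.congr (ae_of_all _ fun x => ?_); simp; ring) hint
  rw [integral_gaussianReal_eq_integral_smul one_ne_zero,
    integral_gaussianReal_eq_integral_smul one_ne_zero]
  simp only [smul_eq_mul]
  rw [h, ← integral_neg]
  congr with x
  ring

/-- Gaussian integration by parts in `ℝ^d`. -/
lemma integral_apply_mul_eq_integral_fderiv_stdGaussian {d : ℕ} (i : Fin d)
    {g : (Fin d → ℝ) → ℝ} (hg : Differentiable ℝ g) (hint : Integrable g (stdGaussian d))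
    (hint' : Integrable (fun w => fderiv ℝ g w (Pi.single i 1)) (stdGaussian d))
    (hmul : Integrable (fun w => w i * g w) (stdGaussian d)) :
    ∫ w, w i * g w ∂stdGaussian d = ∫ w, fderiv ℝ g w (Pi.single i 1) ∂stdGaussian d := by
  obtain _ | n := d
  · exact i.elim0
  obtain ⟨e, hmp, hei, hupd⟩ : ∃ e : ℝ × (Fin n → ℝ) ≃ᵐ (Fin (n + 1) → ℝ),
      MeasurePreserving e ((gaussianReal 0 1).prod (stdGaussian n)) (stdGaussian (n + 1)) ∧
      (∀ a y, e (a, y) i = a) ∧ ∀ a y, e (a, y) = Function.update (e (0, y)) i a :=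
    ⟨(MeasurableEquiv.piFinSuccAbove (fun _ : Fin (n + 1) => ℝ) i).symm,
      (measurePreserving_piFinSuccAbove (fun _ : Fin (n + 1) => gaussianReal 0 1) i).symm,
      fun a y => Fin.insertNth_apply_same (α := fun _ => ℝ) i a y,
      fun a y => (Fin.update_insertNth (α := fun _ => ℝ) i 0 a y).symm⟩
  have hemb := e.measurableEmbedding
  rw [← hmp.integrable_comp_emb hemb] at hint hint' hmul
  rw [← hmp.integral_comp hemb, ← hmp.integral_comp hemb, integral_prod_symm _ (by exact hmul),
    integral_prod_symm _ (by exact hint')]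
  refine integral_congr_ae ?_
  filter_upwards [hint.prod_left_ae, hint'.prod_left_ae, hmul.prod_left_ae] with y h1 h2 h3
  simp only [Function.comp_apply, hei] at h1 h2 h3 ⊢
  refine integral_mul_eq_integral_deriv_gaussianReal (g := fun a => g (e (a, y)))
    (fun a => ?_) h1 h2 h3
  have hd : HasDerivAt (fun a => e (a, y)) (Pi.single i 1) a := by
    rw [funext fun a => hupd a y]
    exact hasDerivAt_update _ _ _
  exact ((hg _).hasFDerivAt).comp_hasDerivAt a hd

lemma one_add_rpow_le_exp_mul {q S : ℝ} (hq : 0 ≤ q) (hS : 0 ≤ S) :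
    (1 + S) ^ q ≤ Real.exp (q * S) := by
  rw [mul_comm, Real.exp_mul]
  exact Real.rpow_le_rpow (by positivity) (by linarith [Real.add_one_le_exp S]) hq

section ExponentialGrowth

variable {d : ℕ} {C q : ℝ}

lemma abs_comp_add_smul_le {g : (Fin d → ℝ) → ℝ} (hq : 0 ≤ q) (hC : 0 ≤ C)
    (hg : ∀ x, |g x| ≤ C * Real.exp (q * ∑ i, |x i|)) {σ R : ℝ} (hσ : |σ| ≤ R)
    (x w : Fin d → ℝ) :
    |g (x + σ • w)| ≤ C * Real.exp (q * ∑ i, |x i|) * Real.exp (q * R * ∑ i, |w i|) := by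
  refine (hg _).trans ?_
  rw [mul_assoc, ← Real.exp_add, mul_assoc q, ← mul_add]
  gcongr
  rw [Finset.mul_sum, ← Finset.sum_add_distrib]
  gcongr with i
  simp only [Pi.add_apply, Pi.smul_apply, smul_eq_mul]
  refine (abs_add_le _ _).trans ?_
  rw [abs_mul]
  gcongr

lemma integrable_comp_add_smul_stdGaussian {g : (Fin d → ℝ) → ℝ} (hcont : Continuous g)
    (hq : 0 ≤ q) (hC : 0 ≤ C) (hg : ∀ x, |g x| ≤ C * Real.exp (q * ∑ i, |x i|))
    (σ : ℝ) (x : Fin d → ℝ) :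
    Integrable (fun w => g (x + σ • w)) (stdGaussian d) :=
  ((integrable_exp_sum_abs_stdGaussian d (q * |σ|)).const_mul _).mono' (by fun_prop)
    (ae_of_all _ fun w => abs_comp_add_smul_le hq hC hg le_rfl x w)

lemma integrable_apply_mul_comp_add_smul_stdGaussian {g : (Fin d → ℝ) → ℝ}
    (hcont : Continuous g) (hq : 0 ≤ q) (hC : 0 ≤ C)
    (hg : ∀ x, |g x| ≤ C * Real.exp (q * ∑ i, |x i|)) (σ : ℝ) (x : Fin d → ℝ) (i : Fin d) :
    Integrable (fun w => w i * g (x + σ • w)) (stdGaussian d) := by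
  refine ((integrable_abs_mul_exp_sum_abs_stdGaussian (q * |σ|) i).const_mul
    (C * Real.exp (q * ∑ i, |x i|))).mono' (by fun_prop) (ae_of_all _ fun w => ?_)
  rw [Real.norm_eq_abs, abs_mul, mul_left_comm]
  gcongr
  exact abs_comp_add_smul_le hq hC hg le_rfl x w

lemma abs_sqrt_two_mul_sub_le {s t : ℝ} (hs : 0 ≤ s) : |√(2 * (t - s))| ≤ √(2 * t) := by
  rw [abs_of_nonneg (Real.sqrt_nonneg _)]
  exact Real.sqrt_le_sqrt (by linarith)

lemma ContinuousOn.continuous_section {X Y : Type*} [TopologicalSpace X] [TopologicalSpace Y]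
    {h : X → Y → ℝ} {s : Set X} (hcont : ContinuousOn (fun p : X × Y => h p.1 p.2) (s ×ˢ univ))
    {a : X} (ha : a ∈ s) : Continuous (h a) :=
  hcont.comp_continuous (f := fun y => (a, y)) (by fun_prop) (fun _ => ⟨ha, mem_univ _⟩)

lemma continuousOn_integral_heat {T t : ℝ} {h : ℝ → (Fin d → ℝ) → ℝ} (htT : t ≤ T)
    (hcont : ContinuousOn (fun p : ℝ × (Fin d → ℝ) => h p.1 p.2) (Icc 0 T ×ˢ univ))
    (hq : 0 ≤ q) (hC : 0 ≤ C)
    (hg : ∀ s ∈ Icc 0 T, ∀ x, |h s x| ≤ C * Real.exp (q * ∑ i, |x i|)) (x : Fin d → ℝ) :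
    ContinuousOn (fun s => ∫ w, h s (x + √(2 * (t - s)) • w) ∂stdGaussian d) (Icc 0 t) := by
  have hsub : Icc 0 t ⊆ Icc 0 T := Icc_subset_Icc_right htT
  have hint : Integrable (fun w : Fin d → ℝ =>
      C * Real.exp (q * ∑ i, |x i|) * Real.exp (q * √(2 * t) * ∑ i, |w i|)) (stdGaussian d) :=
    (integrable_exp_sum_abs_stdGaussian d _).const_mul _
  refine continuousOn_of_dominated (F := fun s w => h s (x + √(2 * (t - s)) • w))
    ?_ ?_ hint ?_
  · intro s hs
    have hcs : Continuous (h s) := hcont.continuous_section (hsub hs)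
    exact (hcs.comp (by fun_prop)).aestronglyMeasurable
  · exact fun s hs => ae_of_all _ fun w =>
      abs_comp_add_smul_le hq hC (hg s (hsub hs)) (abs_sqrt_two_mul_sub_le hs.1) x w
  · refine ae_of_all _ fun w => ?_
    have hcurve : Continuous (fun s : ℝ => (s, x + √(2 * (t - s)) • w)) := by fun_prop
    exact hcont.comp hcurve.continuousOn (fun s hs => ⟨hsub hs, mem_univ _⟩)

end ExponentialGrowth

lemma fderiv_eq_sum_spatialPD1 {d : ℕ} (g : (Fin d → ℝ) → ℝ) (x : Fin d → ℝ) :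
    fderiv ℝ g x = ∑ i, spatialPD1 d g i x • ContinuousLinearMap.proj (R := ℝ) i := by
  ext v
  conv_lhs => rw [pi_eq_sum_univ' v]
  simp [spatialPD1, mul_comm]

/-- Chain rule along a curve for functions of class `C^{1,2}`. -/
lemma IsC12On.hasDerivAt_comp {d : ℕ} {α β : ℝ} {u : ℝ → (Fin d → ℝ) → ℝ}
    (hu : IsC12On d α β u) {s : ℝ} (hs : s ∈ Ioo α β) {y : ℝ → Fin d → ℝ} {y' : Fin d → ℝ}
    (hy : HasDerivAt y y' s) :
    HasDerivAt (fun r => u r (y r))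
      (derivWithin (fun r => u r (y s)) (Icc α β) s +
        ∑ i, spatialPD1 d (u s) i (y s) * y' i) s := by
  obtain ⟨-, hdiff, hdt, hC2, hd1, -⟩ := hu
  have hnhds : Icc α β ×ˢ univ ∈ 𝓝 (s, y s) :=
    prod_mem_nhds (Icc_mem_nhds hs.1 hs.2) univ_mem
  have hev : ∀ᶠ v : ℝ × (Fin d → ℝ) in 𝓝 (s, y s), v.1 ∈ Ioo α β :=
    continuous_fst.continuousAt (Ioo_mem_nhds hs.1 hs.2)
  have key := hasStrictFDerivAt_uncurry_coprod (𝕜 := ℝ) (u := (s, y s)) (f := u)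
    (f₁ := fun r x => ContinuousLinearMap.toSpanSingleton ℝ
      (derivWithin (fun r' => u r' x) (Icc α β) r))
    (f₂ := fun r x => ∑ i, spatialPD1 d (u r) i x • ContinuousLinearMap.proj (R := ℝ) i)
    ?_ ?_ ?_ ?_
  · have := key.hasFDerivAt.comp_hasDerivAt s ((hasDerivAt_id s).prodMk hy)
    refine this.congr_deriv ?_
    simp [Function.HasUncurry.uncurry]
  · filter_upwards [hev] with v hv
    exact ((hdiff v.2 v.1 (Ioo_subset_Icc_self hv)).hasDerivWithinAt.hasDerivAt
      (Icc_mem_nhds hv.1 hv.2)).hasFDerivAt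
  · filter_upwards [hev] with v hv
    have := ((hC2 v.1 (Ioo_subset_Icc_self hv)).differentiable two_ne_zero v.2).hasFDerivAt
    rwa [fderiv_eq_sum_spatialPD1] at this
  · exact (ContinuousLinearMap.toSpanSingletonCLE (𝕜 := ℝ) (E := ℝ)).continuous.continuousAt.comp
      (hdt.continuousAt hnhds)
  · have h : ContinuousAt (fun p : ℝ × (Fin d → ℝ) => ∑ i, spatialPD1 d (u p.1) i p.2 •
        (ContinuousLinearMap.proj i : (Fin d → ℝ) →L[ℝ] ℝ)) (s, y s) :=
      tendsto_finsetSum _ fun i _ => Tendsto.smul_const ((hd1 i).continuousAt hnhds) _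
    exact h

/-- Derivative bounds of exponential type, which imply integrability against Gaussians. -/
def HasExpGrowthDerivs (d : ℕ) (T C q : ℝ) (u : ℝ → (Fin d → ℝ) → ℝ) : Prop :=
  ∀ t ∈ Icc (0 : ℝ) T, ∀ x : Fin d → ℝ,
    |u t x| ≤ C * Real.exp (q * ∑ i, |x i|) ∧
    |derivWithin (fun s => u s x) (Icc (0 : ℝ) T) t| ≤ C * Real.exp (q * ∑ i, |x i|) ∧
    (∀ i, |spatialPD1 d (u t) i x| ≤ C * Real.exp (q * ∑ i, |x i|)) ∧
    (∀ i j, |spatialPD2 d (u t) i j x| ≤ C * Real.exp (q * ∑ i, |x i|))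

lemma HasPolyGrowthDerivs.exists_hasExpGrowthDerivs {d : ℕ} {T : ℝ}
    {u : ℝ → (Fin d → ℝ) → ℝ} (h : HasPolyGrowthDerivs d T u) :
    ∃ C q : ℝ, 0 ≤ C ∧ 0 ≤ q ∧ HasExpGrowthDerivs d T C q u := by
  obtain ⟨c, q, hq, h⟩ := h
  have hq0 : 0 ≤ q := by linarith
  have hle (x : Fin d → ℝ) :
      c * (1 + ∑ i, |x i|) ^ q ≤ |c| * Real.exp (q * ∑ i, |x i|) := by
    have hS : 0 ≤ ∑ i, |x i| := Finset.sum_nonneg fun _ _ => abs_nonneg _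
    exact mul_le_mul (le_abs_self c) (one_add_rpow_le_exp_mul hq0 hS) (by positivity)
      (abs_nonneg c)
  refine ⟨|c|, q, abs_nonneg c, hq0, fun t ht x => ?_⟩
  obtain ⟨h0, h1, h2, h3⟩ := h t ht x
  exact ⟨h0.trans (hle x), h1.trans (hle x), fun i => (h2 i).trans (hle x),
    fun i j => (h3 i j).trans (hle x)⟩

/-- Gaussian integration by parts for the drift term produced by the scaling of the Gaussian. -/
lemma integral_apply_mul_spatialPD1_stdGaussian {d : ℕ} {C q : ℝ} (hC : 0 ≤ C) (hq : 0 ≤ q)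
    {g : (Fin d → ℝ) → ℝ} (hg : ContDiff ℝ 2 g)
    (hg1 : ∀ i x, |spatialPD1 d g i x| ≤ C * Real.exp (q * ∑ i, |x i|))
    (hg2 : ∀ i j x, |spatialPD2 d g i j x| ≤ C * Real.exp (q * ∑ i, |x i|))
    (x : Fin d → ℝ) (σ : ℝ) (i : Fin d) :
    ∫ w, w i * spatialPD1 d g i (x + σ • w) ∂stdGaussian d =
      σ * ∫ w, spatialPD2 d g i i (x + σ • w) ∂stdGaussian d := by
  have hC1 : ContDiff ℝ 1 (spatialPD1 d g i) :=
    (hg.fderiv_right (m := 1) (by norm_num)).clm_apply contDiff_const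
  have hc2 : Continuous (spatialPD2 d g i i) :=
    (hC1.continuous_fderiv one_ne_zero).clm_apply continuous_const
  have hdiff := hC1.differentiable one_ne_zero
  have hfd (w : Fin d → ℝ) :
      fderiv ℝ (fun w => spatialPD1 d g i (x + σ • w)) w (Pi.single i 1) =
        σ * spatialPD2 d g i i (x + σ • w) := by
    have h1 : HasFDerivAt (fun w : Fin d → ℝ => x + σ • w)
        (σ • ContinuousLinearMap.id ℝ (Fin d → ℝ)) w :=
      ((hasFDerivAt_id w).const_smul σ).const_add x
    have h2 : HasFDerivAt (fun w => spatialPD1 d g i (x + σ • w))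
        ((fderiv ℝ (spatialPD1 d g i) (x + σ • w)).comp
          (σ • ContinuousLinearMap.id ℝ (Fin d → ℝ))) w :=
      HasFDerivAt.comp (g := spatialPD1 d g i) w (hdiff (x + σ • w)).hasFDerivAt h1
    rw [h2.fderiv]
    simp only [ContinuousLinearMap.comp_apply, smul_apply,
      ContinuousLinearMap.id_apply, map_smul, smul_eq_mul]
    rfl
  rw [← integral_const_mul]
  simp_rw [← hfd]
  refine integral_apply_mul_eq_integral_fderiv_stdGaussian i
    (hdiff.comp (by fun_prop)) ?_ ?_ ?_
  · exact integrable_comp_add_smul_stdGaussian hC1.continuous hq hC (hg1 i) σ x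
  · simp_rw [hfd]
    exact (integrable_comp_add_smul_stdGaussian hc2 hq hC (hg2 i i) σ x).const_mul σ
  · exact integrable_apply_mul_comp_add_smul_stdGaussian hC1.continuous hq hC (hg1 i) σ x i

/-- Along the heat flow run backwards from time `t`, the time derivative of the Gaussian average
of `u` is the Gaussian average of `∂u/∂t - Δu`. -/
lemma hasDerivAt_integral_heat {d : ℕ} {T t C q : ℝ} {u : ℝ → (Fin d → ℝ) → ℝ}
    (hu : IsC12On d 0 T u) (hC : 0 ≤ C) (hq : 0 ≤ q) (hgr : HasExpGrowthDerivs d T C q u)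
    (htT : t ≤ T) (x : Fin d → ℝ) {s : ℝ} (hs : s ∈ Ioo 0 t) :
    HasDerivAt (fun r => ∫ w, u r (x + √(2 * (t - r)) • w) ∂stdGaussian d)
      (∫ w, (derivWithin (fun r => u r (x + √(2 * (t - s)) • w)) (Icc 0 T) s -
        laplacian d (u s) (x + √(2 * (t - s)) • w)) ∂stdGaussian d) s := by
  have hcu := hu.1
  have hcdt := hu.2.2.1
  have hcC2 := hu.2.2.2.1
  have hc1 := hu.2.2.2.2.1
  have hc2 := hu.2.2.2.2.2
  have hsT : s ∈ Icc 0 T := ⟨hs.1.le, hs.2.le.trans htT⟩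
  set K := C * Real.exp (q * ∑ i, |x i|)
  set M := q * √(2 * t)
  have hK0 : 0 ≤ K := by positivity
  set σ := √(2 * (t - s)) with hσ
  have hσ0 : 0 < σ := Real.sqrt_pos.2 (by linarith [hs.2])
  set F' : ℝ → (Fin d → ℝ) → ℝ := fun r w =>
    derivWithin (fun r' => u r' (x + √(2 * (t - r)) • w)) (Icc 0 T) r +
      ∑ i, spatialPD1 d (u r) i (x + √(2 * (t - r)) • w) * (-(√(2 * (t - r)))⁻¹ * w i) with hF'
  have hcdts : Continuous fun y => derivWithin (fun r => u r y) (Icc 0 T) s :=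
    hcdt.continuous_section (h := fun a y => derivWithin (fun r => u r y) (Icc 0 T) a) hsT
  have hc1s (i) : Continuous (spatialPD1 d (u s) i) :=
    (hc1 i).continuous_section (h := fun a y => spatialPD1 d (u a) i y) hsT
  have hc2s (i) : Continuous (spatialPD2 d (u s) i i) :=
    (hc2 i i).continuous_section (h := fun a y => spatialPD2 d (u a) i i y) hsT
  have hidt : Integrable (fun w => derivWithin (fun r => u r (x + σ • w)) (Icc 0 T) s)
      (stdGaussian d) :=
    integrable_comp_add_smul_stdGaussian hcdts hq hC (fun y => (hgr s hsT y).2.1) σ x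
  have hi1 (i : Fin d) : Integrable (fun w => w i * spatialPD1 d (u s) i (x + σ • w))
      (stdGaussian d) :=
    integrable_apply_mul_comp_add_smul_stdGaussian (hc1s i) hq hC
      (fun y => (hgr s hsT y).2.2.1 i) σ x i
  have hi2 (i : Fin d) : Integrable (fun w => spatialPD2 d (u s) i i (x + σ • w))
      (stdGaussian d) :=
    integrable_comp_add_smul_stdGaussian (hc2s i) hq hC (fun y => (hgr s hsT y).2.2.2 i i) σ x
  have hF's : F' s = fun w => derivWithin (fun r => u r (x + σ • w)) (Icc 0 T) s +
      ∑ i, -σ⁻¹ * (w i * spatialPD1 d (u s) i (x + σ • w)) := by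
    ext w
    simp only [hF', ← hσ]
    congr 1
    exact Finset.sum_congr rfl fun i _ => by ring
  have hval : ∫ w, (derivWithin (fun r => u r (x + σ • w)) (Icc 0 T) s -
        laplacian d (u s) (x + σ • w)) ∂stdGaussian d = ∫ w, F' s w ∂stdGaussian d := by
    simp only [laplacian, hF's]
    rw [integral_sub hidt (integrable_finsetSum _ fun i _ => hi2 i),
      integral_add hidt (integrable_finsetSum _ fun i _ => (hi1 i).const_mul _),
      integral_finsetSum _ fun i _ => hi2 i,
      integral_finsetSum _ fun i _ => (hi1 i).const_mul _, sub_eq_add_neg,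
      ← Finset.sum_neg_distrib]
    congr 1
    refine Finset.sum_congr rfl fun i _ => ?_
    rw [integral_const_mul, integral_apply_mul_spatialPD1_stdGaussian hC hq (hcC2 s hsT)
      (fun i y => (hgr s hsT y).2.2.1 i) (fun i j y => (hgr s hsT y).2.2.2 i j)]
    field_simp
  rw [hval]
  have hN : Ioo 0 ((s + t) / 2) ∈ 𝓝 s := Ioo_mem_nhds hs.1 (by linarith [hs.2])
  have hNt {r : ℝ} (hr : r ∈ Ioo 0 ((s + t) / 2)) : r ∈ Ioo 0 t :=
    ⟨hr.1, by linarith [hr.2, hs.2]⟩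
  have hNT {r : ℝ} (hr : r ∈ Ioo 0 ((s + t) / 2)) : r ∈ Icc 0 T :=
    ⟨hr.1.le, (hNt hr).2.le.trans htT⟩
  have hbint : Integrable (fun w : Fin d → ℝ => K * Real.exp (M * ∑ j, |w j|) +
      ∑ i, K * (√(t - s))⁻¹ * (|w i| * Real.exp (M * ∑ j, |w j|))) (stdGaussian d) :=
    ((integrable_exp_sum_abs_stdGaussian d M).const_mul K).add
      (integrable_finsetSum _ fun i _ =>
        (integrable_abs_mul_exp_sum_abs_stdGaussian M i).const_mul _)
  refine (hasDerivAt_integral_of_dominated_loc_of_deriv_le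
    (F := fun r w => u r (x + √(2 * (t - r)) • w)) (F' := F') hN ?_ ?_ ?_ ?_ hbint ?_).2
  · filter_upwards [hN] with r hr
    have hcs : Continuous (u r) := hcu.continuous_section (hNT hr)
    exact (hcs.comp (by fun_prop)).aestronglyMeasurable
  · exact integrable_comp_add_smul_stdGaussian (hcu.continuous_section hsT) hq hC
      (fun y => (hgr s hsT y).1) _ x
  · rw [hF's]
    exact (hidt.add (integrable_finsetSum _ fun i _ =>
      (hi1 i).const_mul _)).aestronglyMeasurable
  · refine ae_of_all _ fun w r hr => ?_
    have hσr := abs_sqrt_two_mul_sub_le (t := t) hr.1.le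
    refine (norm_add_le _ _).trans (add_le_add ?_ ((norm_sum_le _ _).trans
      (Finset.sum_le_sum fun i _ => ?_)))
    · exact abs_comp_add_smul_le
        (g := fun y => derivWithin (fun r' => u r' y) (Icc 0 T) r) hq hC
        (fun y => (hgr r (hNT hr) y).2.1) hσr x w
    · have h1 := abs_comp_add_smul_le hq hC
        (fun y => (hgr r (hNT hr) y).2.2.1 i) hσr x w
      have h2 : (√(2 * (t - r)))⁻¹ ≤ (√(t - s))⁻¹ :=
        inv_anti₀ (Real.sqrt_pos.2 (by linarith [hs.2]))
          (Real.sqrt_le_sqrt (by linarith [hr.2]))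
      rw [Real.norm_eq_abs, abs_mul, abs_mul, abs_neg, abs_inv,
        abs_of_nonneg (Real.sqrt_nonneg _)]
      calc _ ≤ (K * Real.exp (M * ∑ j, |w j|)) * ((√(t - s))⁻¹ * |w i|) := by
            gcongr
        _ = _ := by ring
  · refine ae_of_all _ fun w r hr => ?_
    have hpos : 2 * (t - r) ≠ 0 := by
      have := (hNt hr).2
      exact mul_ne_zero two_ne_zero (by linarith)
    have hsqrt : HasDerivAt (fun r => √(2 * (t - r))) (-(√(2 * (t - r)))⁻¹) r := by
      refine ((((hasDerivAt_id r).const_sub t).const_mul 2).sqrt hpos).congr_deriv ?_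
      simp only [id]
      field_simp
    have hy : HasDerivAt (fun r => x + √(2 * (t - r)) • w) (-(√(2 * (t - r)))⁻¹ • w) r :=
      (hsqrt.smul_const w).const_add x
    exact hu.hasDerivAt_comp ⟨hr.1, (hNt hr).2.trans_le htT⟩ hy

/-- **Feynman–Kac fixed point formula for semilinear heat equations.** -/
theorem feynman_kac_semilinear
    (d : ℕ) (hd : 0 < d) (T : ℝ) (hT : 0 < T)
    (f : ℝ → ℝ) (hf : ∃ K : NNReal, LipschitzWith K f)
    (u : ℝ → (Fin d → ℝ) → ℝ)
    (hu : IsC12On d 0 T u) (hgrowth : HasPolyGrowthDerivs d T u)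
    (hpde : ∀ t ∈ Icc (0:ℝ) T, ∀ x,
      derivWithin (fun s => u s x) (Icc (0:ℝ) T) t = laplacian d (u t) x + f (u t x)) :
    ∀ t ∈ Icc (0:ℝ) T, ∀ x : Fin d → ℝ,
      u t x =
        (∫ w, u 0 (x + Real.sqrt (2 * t) • w) ∂(stdGaussian d)) +
          ∫ s in (0:ℝ)..t, ∫ w, f (u s (x + Real.sqrt (2 * (t - s)) • w)) ∂(stdGaussian d) := by
  intro t ht x
  obtain ⟨C, q, hC, hq, hgr⟩ := hgrowth.exists_hasExpGrowthDerivs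
  have hfu {s : ℝ} (hs : s ∈ Icc 0 T) (y : Fin d → ℝ) :
      f (u s y) = derivWithin (fun r => u r y) (Icc 0 T) s - laplacian d (u s) y := by
    rw [hpde s hs y]
    ring
  have hcf : ContinuousOn (fun p : ℝ × (Fin d → ℝ) => f (u p.1 p.2)) (Icc 0 T ×ˢ univ) := by
    obtain ⟨K, hK⟩ := hf
    exact hK.continuous.comp_continuousOn hu.1
  have hbf : ∀ s ∈ Icc 0 T, ∀ y : Fin d → ℝ,
      |f (u s y)| ≤ (C + d * C) * Real.exp (q * ∑ i, |y i|) := by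
    intro s hs y
    obtain ⟨-, h1, -, h2⟩ := hgr s hs y
    rw [hfu hs, add_mul]
    refine (abs_sub _ _).trans (add_le_add h1 ((Finset.abs_sum_le_sum_abs _ _).trans
      ((Finset.sum_le_sum fun i _ => h2 i i).trans_eq ?_)))
    simp [mul_assoc]
  have hcont := continuousOn_integral_heat ht.2 hu.1 hq hC (fun s hs y => (hgr s hs y).1) x
  have hcont' := continuousOn_integral_heat (h := fun s y => f (u s y)) ht.2 hcf hq
    (by positivity) hbf x
  have hFTC := intervalIntegral.integral_eq_sub_of_hasDerivAt_of_le ht.1 hcont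
    (f' := fun s => ∫ w, f (u s (x + √(2 * (t - s)) • w)) ∂stdGaussian d)
    (fun s hs => by
      have hsT : s ∈ Icc 0 T := ⟨hs.1.le, hs.2.le.trans ht.2⟩
      simp_rw [hfu hsT]
      exact hasDerivAt_integral_heat hu hC hq hgr ht.2 x hs)
    (hcont'.intervalIntegrable_of_Icc ht.1)
  rw [hFTC]
  simp

end
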